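/- There exists a constant C > 0, independent of k, such that for all n ≥ 1 and for each k ∈ {3,4,5} with k ≤ n! − 3, T(n,k) ≤ (1 + C/n²) · (1/n!²) · binom(n!,k). -/

import Mathlib

open Equiv Finset

/-- Two `k`-subsets of `Sₙ` are equivalent if one is obtained from the other by
two-sided multiplication `σ ↦ g₁ * σ * g₂` for some pair `(g₁, g₂)`. -/
def permSetRel (n k : ℕ) (x y : {s : Finset (Perm (Fin n)) // s.card = k}) : Prop :=
  ∃ g₁ g₂ : Perm (Fin n),
    (x : Finset (Perm (Fin n))).image (fun σ => g₁ * σ * g₂) = (y : Finset (Perm (Fin n)))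

/-- `T n k` is the number of orbits of the action of `Sₙ × Sₙ` on the family of
`k`-element subsets of `Sₙ`. -/
noncomputable def T (n k : ℕ) : ℕ := Nat.card (Quot (permSetRel n k))

open scoped Nat

def wt (c : Multiset ℕ) : ℕ := c.prod * ∏ i ∈ c.toFinset, (c.count i)!

lemma wt_cons (i : ℕ) (c : Multiset ℕ) : wt (i ::ₘ c) = i * (c.count i + 1) * wt c := by
  have h : ∀ d : Multiset ℕ, d.toFinset ⊆ insert i c.toFinset →
      ∏ j ∈ d.toFinset, (d.count j)! = ∏ j ∈ insert i c.toFinset, (d.count j)! := by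
    intro d hd
    refine Finset.prod_subset hd ?_
    intro x _ hx
    rw [Multiset.mem_toFinset] at hx
    rw [Multiset.count_eq_zero_of_notMem hx]; rfl
  unfold wt
  rw [h c (Finset.subset_insert _ _), h (i ::ₘ c) (by simp)]
  rw [← Finset.mul_prod_erase (insert i c.toFinset) (fun j => ((i ::ₘ c).count j)!)
        (Finset.mem_insert_self _ _),
      ← Finset.mul_prod_erase (insert i c.toFinset) (fun j => (c.count j)!)
        (Finset.mem_insert_self _ _)]
  have : ∏ j ∈ (insert i c.toFinset).erase i, ((i ::ₘ c).count j)! =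
      ∏ j ∈ (insert i c.toFinset).erase i, (c.count j)! := by
    refine Finset.prod_congr rfl ?_
    intro j hj
    rw [Multiset.count_cons_of_ne (Finset.ne_of_mem_erase hj)]
  rw [this, Multiset.prod_cons, Multiset.count_cons_self, Nat.factorial_succ]
  ring

lemma wt_le_erase (i : ℕ) (c : Multiset ℕ) (hi : i ∈ c) : wt c ≤ c.sum * wt (c.erase i) := by
  obtain ⟨d, rfl⟩ := Multiset.exists_cons_of_mem hi
  rw [wt_cons, Multiset.erase_cons_head]
  refine Nat.mul_le_mul_right _ ?_
  have : Multiset.replicate (d.count i + 1) i ≤ i ::ₘ d := by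
    rw [← Multiset.le_count_iff_replicate_le]; simp
  obtain ⟨e, he⟩ := Multiset.le_iff_exists_add.1 this
  rw [he, Multiset.sum_add, Multiset.sum_replicate, smul_eq_mul, mul_comm]
  exact Nat.le_add_right _ _

def sq' : ℕ → ℕ
  | 0 => 1
  | 1 => 1
  | (j+2) => sq' (j+1) + (j+2) * sq' j

lemma sum_wt_le (j : ℕ) : ∀ S : Finset (Multiset ℕ), (∀ c ∈ S, c.sum ≤ j ∧ ∀ a ∈ c, 2 ≤ a) →
    ∑ c ∈ S, wt c ≤ sq' j := by
  have base : ∀ S : Finset (Multiset ℕ), (∀ c ∈ S, c.sum ≤ 1 ∧ ∀ a ∈ c, 2 ≤ a) →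
      ∑ c ∈ S, wt c ≤ 1 := by
    intro S hS
    have : S ⊆ {0} := by
      intro c hc
      obtain ⟨h1, h2⟩ := hS c hc
      rw [Finset.mem_singleton]
      refine Multiset.eq_zero_of_forall_notMem ?_
      intro a ha
      have := Multiset.single_le_sum (fun _ _ => Nat.zero_le _) a ha
      have := h2 a ha
      omega
    refine (Finset.sum_le_sum_of_subset this).trans ?_
    simp [wt]
  induction j using sq'.induct with
  | case1 => intro S hS; exact base S (fun c hc => ⟨(hS c hc).1.trans (by norm_num), (hS c hc).2⟩)
  | case2 => intro S hS; exact base S hS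
  | case3 j ih1 ih0 =>
    intro S hS
    rw [← Finset.sum_filter_add_sum_filter_not S (fun c => c.sum ≤ j + 1), sq']
    refine Nat.add_le_add (ih1 _ ?_) ?_
    · intro c hc
      rw [Finset.mem_filter] at hc
      exact ⟨hc.2, (hS c hc.1).2⟩
    · set S' := S.filter (fun c => ¬ c.sum ≤ j + 1) with hS'
      have hs : ∀ c ∈ S', c.sum = j + 2 := by
        intro c hc
        rw [hS', Finset.mem_filter] at hc
        have := (hS c hc.1).1
        omega
      have hne : ∀ c ∈ S', ∃ a, a ∈ c := by
        intro c hc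
        refine Multiset.exists_mem_of_ne_zero ?_
        rintro rfl
        have := hs _ hc
        simp at this
      choose! i hi using hne
      have hsum : ∀ c ∈ S', i c + (c.erase (i c)).sum = j + 2 := by
        intro c hc
        rw [← hs c hc, ← Multiset.sum_cons, Multiset.cons_erase (hi c hc)]
      have hinj : Set.InjOn (fun c => c.erase (i c)) (S' : Set (Multiset ℕ)) := by
        intro c hc d hd hcd
        simp only at hcd
        have h1 := hsum c hc
        have h2 := hsum d hd
        rw [hcd] at h1
        have h3 : i c = i d := by omega
        rw [← Multiset.cons_erase (hi c hc), hcd, h3, Multiset.cons_erase (hi d hd)]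
      calc ∑ c ∈ S', wt c ≤ ∑ c ∈ S', (j+2) * wt (c.erase (i c)) := by
            refine Finset.sum_le_sum ?_
            intro c hc
            rw [← hs c hc]
            exact wt_le_erase _ _ (hi c hc)
        _ = (j+2) * ∑ c ∈ S'.image (fun c => c.erase (i c)), wt c := by
            rw [Finset.sum_image hinj, Finset.mul_sum]
        _ ≤ (j+2) * sq' j := by
            refine Nat.mul_le_mul_left _ (ih0 _ ?_)
            intro d hd
            rw [Finset.mem_image] at hd
            obtain ⟨c, hc, rfl⟩ := hd
            have hcS : c ∈ S := (Finset.mem_filter.1 hc).1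
            refine ⟨?_, fun a ha => (hS c hcS).2 a (Multiset.mem_of_mem_erase ha)⟩
            have := hsum c hc
            have := (hS c hcS).2 _ (hi c hc)
            omega

lemma sq'_le (j : ℕ) : sq' (j+2) ≤ 9 * j ! := by
  induction j using Nat.strong_induction_on with
  | _ j ih =>
    rcases j with _ | _ | _ | _ | j
    · decide
    · decide
    · decide
    · decide
    · have h1 := ih (j+3) (by omega)
      have h0 := ih (j+2) (by omega)
      rw [sq']
      have e1 : (j+3)! = (j+3) * (j+2)! := Nat.factorial_succ _
      have e2 : (j+4)! = (j+4) * ((j+3) * (j+2)!) := by rw [Nat.factorial_succ, Nat.factorial_succ]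
      show sq' (j+3+2) + (j+4+2) * sq' (j+2+2) ≤ 9 * (j+4)!
      rw [e2]
      rw [e1] at h1
      have := Nat.mul_le_mul_left (j+4+2) h0
      nlinarith [Nat.factorial_pos (j+2), Nat.zero_le (j * (j+2)!), Nat.zero_le (j * j * (j+2)!)]

lemma fact_mul_le (a b : ℕ) : (a+1)! * (b+1)! ≤ (a+b+1)! := by
  induction b with
  | zero => simp
  | succ b ih =>
    rw [Nat.factorial_succ (b+1), show a + (b+1) + 1 = (a+b+1)+1 by ring, Nat.factorial_succ (a+b+1)]
    calc _ = (b+1+1) * ((a+1)! * (b+1)!) := by ring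
      _ ≤ _ := Nat.mul_le_mul (by omega) ih

lemma sum_fact_le (m : ℕ) : ∑ i ∈ Finset.range (m+1), (m - i)! * i ! ≤ 3 * m ! := by
  rcases m with _ | m
  · simp
  · rw [Finset.sum_range_succ, Finset.sum_range_succ']
    have : ∑ i ∈ Finset.range m, (m + 1 - (i+1))! * (i+1)! ≤ ∑ i ∈ Finset.range m, m ! := by
      refine Finset.sum_le_sum ?_
      intro i hi
      rw [Finset.mem_range] at hi
      obtain ⟨t, rfl⟩ := Nat.exists_eq_add_of_lt hi
      have := fact_mul_le t i
      rw [show i + t + 1 + 1 - (i+1) = t + 1 by omega, show i + t + 1 = t + i + 1 by ring]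
      exact this
    rw [Finset.sum_const, Finset.card_range, smul_eq_mul] at this
    have e := Nat.factorial_succ m
    simp only [Nat.sub_self, Nat.sub_zero, Nat.factorial_zero, mul_one, one_mul]
    nlinarith [Nat.factorial_pos m]

/-- the sum over nontrivial cycle types of centralizer sizes -/
lemma sum_z_le (n : ℕ) (hn : 2 ≤ n) (S : Finset (Multiset ℕ))
    (hS : ∀ c ∈ S, c.sum ≤ n ∧ (∀ a ∈ c, 2 ≤ a) ∧ c ≠ 0) :
    ∑ c ∈ S, (n - c.sum)! * wt c ≤ 27 * (n-2)! := by
  obtain ⟨m, rfl⟩ := Nat.exists_eq_add_of_le' hn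
  have hmap : ∀ c ∈ S, c.sum - 2 ∈ Finset.range (m+1) := by
    intro c hc
    have := (hS c hc).1
    rw [Finset.mem_range]; omega
  have h2 : ∀ c ∈ S, 2 ≤ c.sum := by
    intro c hc
    obtain ⟨a, ha⟩ := Multiset.exists_mem_of_ne_zero (hS c hc).2.2
    have := Multiset.single_le_sum (fun _ _ => Nat.zero_le _) a ha
    have := (hS c hc).2.1 a ha
    omega
  rw [← Finset.sum_fiberwise_of_maps_to hmap]
  calc _ ≤ ∑ i ∈ Finset.range (m+1), (m - i)! * (9 * i !) := by
        refine Finset.sum_le_sum ?_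
        intro i hi
        calc _ = ∑ c ∈ S.filter (fun c => c.sum - 2 = i), (m - i)! * wt c := by
              refine Finset.sum_congr rfl ?_
              intro c hc
              rw [Finset.mem_filter] at hc
              have := h2 c hc.1
              congr 2
              omega
          _ = (m - i)! * ∑ c ∈ S.filter (fun c => c.sum - 2 = i), wt c := by rw [Finset.mul_sum]
          _ ≤ _ := by
              refine Nat.mul_le_mul_left _ ((sum_wt_le (i+2) _ ?_).trans (sq'_le i))
              intro c hc
              rw [Finset.mem_filter] at hc
              exact ⟨by omega, (hS c hc.1).2.1⟩
    _ = 9 * ∑ i ∈ Finset.range (m+1), (m - i)! * i ! := by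
        rw [Finset.mul_sum]; refine Finset.sum_congr rfl ?_; intros; ring
    _ ≤ _ := by
        have := sum_fact_le m
        simp only [Nat.add_sub_cancel]
        omega

def cen {n : ℕ} (g : Perm (Fin n)) : ℕ := (Finset.univ.filter fun σ : Perm (Fin n) => g * σ = σ * g).card

lemma cen_eq {n : ℕ} (g : Perm (Fin n)) : cen g = (n - g.cycleType.sum)! * wt g.cycleType := by
  have h := Equiv.Perm.nat_card_centralizer g
  rw [Fintype.card_fin, mul_assoc] at h
  unfold wt
  rw [← h, cen, ← Fintype.card_subtype, ← Nat.card_eq_fintype_card]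
  refine Nat.card_congr (Equiv.subtypeEquivRight ?_)
  intro σ
  rw [Subgroup.mem_centralizer_singleton_iff]
  exact eq_comm

lemma card_P (n : ℕ) : (Finset.univ : Finset (Perm (Fin n))).card = n ! := by
  rw [Finset.card_univ, Fintype.card_perm, Fintype.card_fin]

lemma cen_le {n : ℕ} (g : Perm (Fin n)) : cen g ≤ n ! := by
  rw [← card_P]; exact Finset.card_le_card (Finset.filter_subset _ _)

lemma class_mul {n : ℕ} (c : Multiset ℕ) (hc : c.sum ≤ n ∧ ∀ a ∈ c, 2 ≤ a) :
    (Finset.univ.filter fun g : Perm (Fin n) => g.cycleType = c).card * ((n - c.sum)! * wt c) = n ! := by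
  have h := Equiv.Perm.card_of_cycleType_mul_eq (Fin n) c
  rw [Fintype.card_fin, if_pos hc, mul_assoc _ c.prod] at h
  exact h

lemma cycleType_ok {n : ℕ} (g : Perm (Fin n)) : g.cycleType.sum ≤ n ∧ ∀ a ∈ g.cycleType, 2 ≤ a := by
  refine ⟨?_, fun a ha => Equiv.Perm.two_le_of_mem_cycleType ha⟩
  rw [Equiv.Perm.sum_cycleType]
  exact (Finset.card_le_univ _).trans (by simp)

lemma n2_fact (n : ℕ) (hn : 2 ≤ n) : n^2 * (n-2)! ≤ 2 * n ! := by
  obtain ⟨m, rfl⟩ := Nat.exists_eq_add_of_le' hn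
  rw [Nat.factorial_succ, Nat.factorial_succ, Nat.add_sub_cancel]
  nlinarith [Nat.factorial_pos m, Nat.zero_le (m * m !), Nat.zero_le (m * m * m !)]

lemma sum_cen_sq (n : ℕ) (hn : 2 ≤ n) :
    n^2 * ∑ g ∈ Finset.univ.filter (fun g : Perm (Fin n) => g ≠ 1), cen g ^ 2 ≤ 54 * (n !)^2 := by
  set E := Finset.univ.filter (fun g : Perm (Fin n) => g ≠ 1) with hE
  set S := E.image (fun g => g.cycleType) with hS
  have hmaps : ∀ g ∈ E, g.cycleType ∈ S := fun g hg => Finset.mem_image_of_mem _ hg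
  have key : ∑ g ∈ E, cen g ^ 2 ≤ n ! * ∑ c ∈ S, (n - c.sum)! * wt c := by
    rw [← Finset.sum_fiberwise_of_maps_to hmaps, Finset.mul_sum]
    refine Finset.sum_le_sum ?_
    intro c hc
    have hok : c.sum ≤ n ∧ ∀ a ∈ c, 2 ≤ a := by
      obtain ⟨g, _, rfl⟩ := Finset.mem_image.1 hc
      exact cycleType_ok g
    calc _ ≤ ∑ g ∈ Finset.univ.filter (fun g : Perm (Fin n) => g.cycleType = c),
            ((n - c.sum)! * wt c)^2 := by
          have : ∀ g ∈ E.filter (fun g => g.cycleType = c), cen g ^ 2 = ((n - c.sum)! * wt c)^2 := by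
            intro g hg
            rw [cen_eq, (Finset.mem_filter.1 hg).2]
          rw [Finset.sum_congr rfl this]
          refine Finset.sum_le_sum_of_subset ?_
          intro g hg
          simp only [Finset.mem_filter, Finset.mem_univ, true_and] at hg ⊢
          exact hg.2
      _ = _ := by
          rw [Finset.sum_const, smul_eq_mul, sq, ← mul_assoc, class_mul c hok]
  have hz := sum_z_le n hn S (by
    intro c hc
    obtain ⟨g, hg, rfl⟩ := Finset.mem_image.1 hc
    refine ⟨(cycleType_ok g).1, (cycleType_ok g).2, ?_⟩
    rw [Ne, Equiv.Perm.cycleType_eq_zero]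
    exact (Finset.mem_filter.1 hg).2)
  have h2 := n2_fact n hn
  calc _ ≤ n^2 * (n ! * (27 * (n-2)!)) := by gcongr; exact key.trans (Nat.mul_le_mul_left _ hz)
    _ = 27 * n ! * (n^2 * (n-2)!) := by ring
    _ ≤ 27 * n ! * (2 * n !) := by gcongr
    _ = _ := by ring

lemma cen_bound (n : ℕ) (hn : 2 ≤ n) (h : Perm (Fin n)) (hh : h ≠ 1) : n^2 * cen h ≤ 54 * n ! := by
  have h1 := sum_cen_sq n hn
  have h2 : n ! * cen h ≤ ∑ g ∈ Finset.univ.filter (fun g : Perm (Fin n) => g ≠ 1), cen g ^ 2 := by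
    calc _ = ∑ g ∈ Finset.univ.filter (fun g : Perm (Fin n) => g.cycleType = h.cycleType), cen h ^ 2 := by
          rw [Finset.sum_const, smul_eq_mul, sq, ← mul_assoc, ← class_mul _ (cycleType_ok h), ← cen_eq]
      _ = ∑ g ∈ Finset.univ.filter (fun g : Perm (Fin n) => g.cycleType = h.cycleType), cen g ^ 2 := by
          refine Finset.sum_congr rfl ?_
          intro g hg
          rw [cen_eq, cen_eq, (Finset.mem_filter.1 hg).2]
      _ ≤ _ := by
          refine Finset.sum_le_sum_of_subset ?_
          intro g hg
          simp only [Finset.mem_filter, Finset.mem_univ, true_and] at hg ⊢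
          rintro rfl
          apply hh
          rw [← Equiv.Perm.cycleType_eq_zero, ← hg, Equiv.Perm.cycleType_one]
  have h3 := Nat.factorial_pos n
  refine Nat.le_of_mul_le_mul_left ?_ h3
  nlinarith [Nat.mul_le_mul_left (n^2) h2]

/-- number of solutions of `g^d = 1` -/
def rt (n d : ℕ) : ℕ := (Finset.univ.filter fun g : Perm (Fin n) => g ^ d = 1).card

lemma sum_cen (n : ℕ) : ∑ g : Perm (Fin n), cen g ≤ 2^n * n ! := by
  classical
  have h := card_comm_eq_card_conjClasses_mul_card (Perm (Fin n))
  have h1 : ∑ g : Perm (Fin n), cen g = Nat.card { p : Perm (Fin n) × Perm (Fin n) // Commute p.1 p.2 } := by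
    unfold cen
    rw [← Finset.card_sigma, Nat.card_eq_fintype_card, Fintype.card_subtype]
    refine Finset.card_bij' (fun p _ => (p.1, p.2)) (fun p _ => ⟨p.1, p.2⟩) ?_ ?_ ?_ ?_
    · intro p hp; simp at hp ⊢; exact hp
    · intro p hp; simp at hp ⊢; exact hp
    · intros; rfl
    · intros; rfl
  have h2 : Nat.card (ConjClasses (Perm (Fin n))) ≤ 2^n := by
    have hinj : Function.Injective (Quotient.lift (s := IsConj.setoid (Perm (Fin n)))
        (fun g => g.partition) (fun a b hab => Equiv.Perm.partition_eq_of_isConj.1 hab)) := by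
      intro a b
      induction a using Quotient.inductionOn
      induction b using Quotient.inductionOn
      intro hab
      exact Quotient.sound (Equiv.Perm.partition_eq_of_isConj.2 hab)
    have a1 := Nat.card_le_card_of_injective _ hinj
    have a2 := Nat.card_le_card_of_surjective _ (Nat.Partition.ofComposition_surj (n := Fintype.card (Fin n)))
    rw [Nat.card_eq_fintype_card (α := Composition _), composition_card, Fintype.card_fin] at a2
    refine (a1.trans ?_).trans (a2.trans (Nat.pow_le_pow_right (by norm_num) (Nat.sub_le _ _)))
    rw [Fintype.card_fin]
  rw [h1, h]
  rw [Nat.card_eq_fintype_card (α := Perm (Fin n)), Fintype.card_perm, Fintype.card_fin]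
  gcongr

lemma rt2_sq (n : ℕ) : (rt n 2)^2 ≤ 2^n * n ! := by
  refine le_trans ?_ (sum_cen n)
  unfold rt
  set I := Finset.univ.filter fun g : Perm (Fin n) => g ^ 2 = 1 with hI
  rw [sq, ← Finset.card_product]
  rw [Finset.card_eq_sum_card_fiberwise (f := fun p => p.1 * p.2) (t := Finset.univ) (by intro x _; simp)]
  refine Finset.sum_le_sum ?_
  intro h _
  set F := (I ×ˢ I).filter (fun p => p.1 * p.2 = h) with hF
  rcases F.eq_empty_or_nonempty with he | ⟨p0, hp0⟩
  · rw [he]; simp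
  · have hinv : ∀ p ∈ F, p.1⁻¹ * h * p.1 = h⁻¹ ∧ p.1 * p.2 = h := by
      intro p hp
      simp only [hF, hI, Finset.mem_filter, Finset.mem_product, Finset.mem_univ, true_and] at hp
      obtain ⟨⟨h1, h2⟩, h3⟩ := hp
      refine ⟨?_, h3⟩
      rw [← h3, sq] at *
      have e1 : p.1⁻¹ = p.1 := inv_eq_of_mul_eq_one_left h1
      have e2 : p.2⁻¹ = p.2 := inv_eq_of_mul_eq_one_left h2
      rw [mul_inv_rev, e2, e1]
      rw [← mul_assoc, h1, one_mul]
    refine Finset.card_le_card_of_injOn (fun p => p.1 * p0.1⁻¹) ?_ ?_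
    · intro p hp
      have a := (hinv p hp).1
      have b := (hinv p0 hp0).1
      simp only [Finset.coe_filter, Finset.mem_univ, true_and, Set.mem_ofPred_eq]
      have a' : h * p.1 = p.1 * h⁻¹ := by rw [← a]; group
      have b' : p0.1⁻¹ * h = h⁻¹ * p0.1⁻¹ := by rw [← b]; group
      rw [← mul_assoc, a', mul_assoc, mul_assoc, b']
    · intro p hp q hq hpq
      have e1 : p.1 = q.1 := mul_right_cancel hpq
      have e2 : p.1 * p.2 = q.1 * q.2 := (hinv p hp).2.trans (hinv q hq).2.symm
      rw [e1] at e2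
      exact Prod.ext e1 (mul_left_cancel e2)

lemma rt2_bound : ∃ K : ℕ, ∀ n : ℕ, n^2 * rt n 2 ≤ K * n ! := by
  have hk : ∃ K : ℕ, ∀ n : ℕ, n^4 * 2^n ≤ K * n ! := by
    obtain ⟨K, hK⟩ := exists_nat_ge (24 * Real.exp 6)
    refine ⟨K, fun n => ?_⟩
    have h1 := Real.pow_div_factorial_le_exp (x := (n:ℝ)) (by positivity) 4
    have h2 := Real.pow_div_factorial_le_exp (x := (6:ℝ)) (by positivity) n
    have h3 : Real.exp (n:ℝ) ≤ 3^n := by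
      rw [← Real.exp_one_pow]
      gcongr
      exact Real.exp_one_lt_d9.le.trans (by norm_num)
    have hp : (0:ℝ) < (n ! : ℝ) := by exact_mod_cast Nat.factorial_pos n
    rw [div_le_iff₀ hp] at h2
    rw [div_le_iff₀ (by positivity)] at h1
    have h4 : ((4 ! : ℕ) : ℝ) = 24 := by norm_num [Nat.factorial]
    rw [h4] at h1
    have : (n:ℝ)^4 * 2^n ≤ K * n ! := by
      calc (n:ℝ)^4 * 2^n ≤ (3^n * 24) * 2^n := by gcongr; exact h1.trans (by gcongr)
        _ = 24 * 6^n := by rw [show (6:ℝ) = 3 * 2 by norm_num, mul_pow]; ring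
        _ ≤ 24 * (Real.exp 6 * n !) := by gcongr
        _ = (24 * Real.exp 6) * n ! := by ring
        _ ≤ _ := by gcongr
    exact_mod_cast this
  obtain ⟨K, hK⟩ := hk
  refine ⟨K + 1, fun n => ?_⟩
  rw [← Nat.pow_le_pow_iff_left (n := 2) (by norm_num)]
  calc (n^2 * rt n 2)^2 = n^4 * (rt n 2)^2 := by ring
    _ ≤ n^4 * (2^n * n !) := by gcongr; exact rt2_sq n
    _ = (n^4 * 2^n) * n ! := by ring
    _ ≤ (K * n !) * n ! := by exact Nat.mul_le_mul_right _ (hK n)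
    _ ≤ _ := by nlinarith [Nat.zero_le (n ! * n !), Nat.zero_le (K * (n ! * n !)), Nat.zero_le (K * K * (n ! * n !))]

lemma card_fix1 (n : ℕ) (x : Fin n) :
    (Finset.univ.filter fun g : Perm (Fin n) => g x = x).card ≤ (n-1)! := by
  have h := Fintype.card_congr (Equiv.Perm.subtypeEquivSubtypePerm (fun a : Fin n => a ≠ x))
  rw [Fintype.card_perm, Fintype.card_subtype] at h
  rw [Fintype.card_subtype] at h
  have h2 : (Finset.univ.filter fun a : Fin n => a ≠ x).card = n - 1 := by
    rw [Finset.filter_ne', Finset.card_erase_of_mem (Finset.mem_univ _)]; simp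
  rw [h2] at h
  rw [h]
  refine Finset.card_le_card ?_
  intro g hg
  simp only [Finset.mem_filter, Finset.mem_univ, true_and] at hg ⊢
  intro a ha
  rw [not_not] at ha
  rw [ha, hg]

lemma card_fix3 (n : ℕ) (x y z : Fin n) (hxy : x ≠ y) (hxz : x ≠ z) (hyz : y ≠ z) :
    (Finset.univ.filter fun g : Perm (Fin n) => g x = x ∧ g y = y ∧ g z = z).card ≤ (n-3)! := by
  have h := Fintype.card_congr (Equiv.Perm.subtypeEquivSubtypePerm
    (fun a : Fin n => a ∉ ({x, y, z} : Finset (Fin n))))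
  rw [Fintype.card_perm, Fintype.card_subtype] at h
  rw [Fintype.card_subtype] at h
  have h2 : (Finset.univ.filter fun a : Fin n => a ∉ ({x, y, z} : Finset (Fin n))).card = n - 3 := by
    rw [Finset.filter_notMem_eq_sdiff, Finset.card_sdiff_of_subset (Finset.subset_univ _),
      Finset.card_eq_three.2 ⟨x, y, z, hxy, hxz, hyz, rfl⟩]; simp
  rw [h2] at h
  rw [h]
  refine Finset.card_le_card ?_
  intro g hg
  simp only [Finset.mem_filter, Finset.mem_univ, true_and] at hg ⊢
  intro a ha
  rw [not_not] at ha
  simp only [Finset.mem_insert, Finset.mem_singleton] at ha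
  rcases ha with rfl | rfl | rfl
  · exact hg.1
  · exact hg.2.1
  · exact hg.2.2

lemma card_cyc3 (n : ℕ) (x y z : Fin n) (hxy : x ≠ y) :
    (Finset.univ.filter fun g : Perm (Fin n) => g x = y ∧ g y = z ∧ g z = x).card ≤ (n-3)! := by
  rcases (Finset.univ.filter fun g : Perm (Fin n) => g x = y ∧ g y = z ∧ g z = x).eq_empty_or_nonempty
    with he | ⟨g0, hg0⟩
  · rw [he]; simp
  · simp only [Finset.mem_filter, Finset.mem_univ, true_and] at hg0
    obtain ⟨a, b, c⟩ := hg0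
    have hxz : x ≠ z := by
      rintro rfl
      exact hxy (c.symm.trans a)
    have hyz : y ≠ z := by
      rintro rfl
      exact hxy (c.symm.trans b)
    refine le_trans ?_ (card_fix3 n x y z hxy hxz hyz)
    refine Finset.card_le_card_of_injOn (fun g => g0⁻¹ * g) ?_ ?_
    · intro g hg
      simp only [Finset.coe_filter, Finset.mem_univ, true_and, Set.mem_ofPred_eq] at hg ⊢
      simp only [Equiv.Perm.mul_apply, Equiv.Perm.inv_eq_iff_eq]
      rw [hg.1, hg.2.1, hg.2.2, a, b, c]
      exact ⟨rfl, rfl, rfl⟩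
    · intro g _ h _ hgh
      exact mul_left_cancel hgh

lemma card_pt3 (n : ℕ) (x : Fin n) :
    (Finset.univ.filter fun g : Perm (Fin n) => (g^3) x = x).card ≤ (n-1)! + n^2 * (n-3)! := by
  have hsub : (Finset.univ.filter fun g : Perm (Fin n) => (g^3) x = x) ⊆
      (Finset.univ.filter fun g : Perm (Fin n) => g x = x) ∪
      (Finset.univ.filter fun p : Fin n × Fin n => x ≠ p.1).biUnion
        (fun p => Finset.univ.filter fun g : Perm (Fin n) => g x = p.1 ∧ g p.1 = p.2 ∧ g p.2 = x) := by
    intro g hg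
    simp only [Finset.mem_filter, Finset.mem_univ, true_and, Finset.mem_union, Finset.mem_biUnion] at hg ⊢
    by_cases h : g x = x
    · exact Or.inl h
    · right
      refine ⟨(g x, g (g x)), fun h' => h h'.symm, rfl, rfl, ?_⟩
      simpa [pow_succ] using hg
  refine (Finset.card_le_card hsub).trans ((Finset.card_union_le _ _).trans ?_)
  refine Nat.add_le_add (card_fix1 n x) ?_
  refine (Finset.card_biUnion_le_card_mul _ _ ((n-3)!) ?_).trans ?_
  · intro p hp
    exact card_cyc3 n x p.1 p.2 (Finset.mem_filter.1 hp).2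
  · refine Nat.mul_le_mul_right _ ((Finset.card_le_univ _).trans ?_)
    simp [sq]

lemma rt3_bound (n : ℕ) (hn : 3 ≤ n) : n * rt n 3 ≤ 6 * n ! := by
  have h1 : n * rt n 3 ≤ ∑ x : Fin n, (Finset.univ.filter fun g : Perm (Fin n) => (g^3) x = x).card := by
    have : n * rt n 3 = ∑ x : Fin n, rt n 3 := by simp
    rw [this]
    refine Finset.sum_le_sum ?_
    intro x _
    refine Finset.card_le_card ?_
    intro g hg
    simp only [Finset.mem_filter, Finset.mem_univ, true_and] at hg ⊢
    rw [hg]; rfl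
  have h2 : ∑ x : Fin n, (Finset.univ.filter fun g : Perm (Fin n) => (g^3) x = x).card
      ≤ n * ((n-1)! + n^2 * (n-3)!) := by
    refine (Finset.sum_le_sum (fun x _ => card_pt3 n x)).trans ?_
    simp
  refine h1.trans (h2.trans ?_)
  obtain ⟨m, rfl⟩ := Nat.exists_eq_add_of_le' hn
  rw [show m + 3 - 1 = m + 2 by omega, Nat.add_sub_cancel, Nat.factorial_succ (m+2),
    Nat.factorial_succ (m+1), Nat.factorial_succ m]
  have : (m+3) * (((m+1+1) * ((m+1) * m !)) + (m+3)^2 * m !) = (m+3) * m ! * ((m+2)*(m+1) + (m+3)^2) := by ring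
  rw [this]
  have h3 : (m+2)*(m+1) + (m+3)^2 ≤ 6 * ((m+2)*(m+1)) := by nlinarith
  calc _ ≤ (m+3) * m ! * (6 * ((m+2)*(m+1))) := by gcongr
    _ = _ := by ring

section inv
variable {α : Type*} [Fintype α] [DecidableEq α] [Nonempty α]

def invSets (τ : Perm α) (k : ℕ) : Finset (Finset α) :=
  Finset.univ.filter fun x => x.card = k ∧ x.image τ = x

def fixS (τ : Perm α) (d : ℕ) : Finset α := Finset.univ.filter fun a => (τ^d) a = a

lemma inv_rec (τ : Perm α) (k : ℕ) (hk : 1 ≤ k) :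
    (invSets τ k).card ≤ ∑ d ∈ Finset.Icc 1 k, (fixS τ d).card * (invSets τ (k-d)).card := by
  have hne : ∀ x ∈ invSets τ k, ∃ a, a ∈ x := by
    intro x hx
    simp only [invSets, Finset.mem_filter, Finset.mem_univ, true_and] at hx
    exact Finset.card_pos.1 (by omega)
  choose! a ha using hne
  set dd : Finset α → ℕ := fun x => Function.minimalPeriod τ (a x) with hdd
  set O : Finset α → Finset α := fun x => (Finset.range (dd x)).image (fun i => τ^[i] (a x)) with hO
  have hpos : ∀ x, 0 < dd x := by
    intro x
    refine Function.minimalPeriod_pos_of_mem_periodicPts ?_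
    refine ⟨orderOf τ, orderOf_pos τ, ?_⟩
    rw [Function.IsPeriodicPt, Equiv.Perm.iterate_eq_pow, pow_orderOf_eq_one]
    rfl
  have hOc : ∀ x, (O x).card = dd x := by
    intro x
    rw [hO, Finset.card_image_of_injOn, Finset.card_range]
    intro i hi j hj hij
    exact Function.iterate_injOn_Iio_minimalPeriod (by simpa using hi) (by simpa using hj) hij
  have hper : ∀ x, τ^[dd x] (a x) = a x := fun x => Function.iterate_minimalPeriod
  have hOi : ∀ x, (O x).image τ = O x := by
    intro x
    refine Finset.eq_of_subset_of_card_le ?_ ?_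
    · intro b hb
      simp only [hO, Finset.mem_image, Finset.mem_range] at hb ⊢
      obtain ⟨c, ⟨i, hi, rfl⟩, rfl⟩ := hb
      by_cases h : i + 1 < dd x
      · exact ⟨i+1, h, Function.iterate_succ_apply' _ _ _⟩
      · refine ⟨0, hpos x, ?_⟩
        rw [← Function.iterate_succ_apply' (⇑τ), show i.succ = dd x by omega, hper]
        rfl
    · rw [Finset.card_image_of_injective _ τ.injective]
  have hOx : ∀ x ∈ invSets τ k, O x ⊆ x := by
    intro x hx b hb
    simp only [hO, Finset.mem_image, Finset.mem_range] at hb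
    obtain ⟨i, _, rfl⟩ := hb
    have hxi : x.image τ = x := by
      simp only [invSets, Finset.mem_filter, Finset.mem_univ, true_and] at hx
      exact hx.2
    clear * - hx hxi ha
    induction i with
    | zero => exact ha x hx
    | succ i ih =>
      rw [Function.iterate_succ_apply']
      exact hxi.subset (Finset.mem_image_of_mem _ ih)
  have hle : ∀ x ∈ invSets τ k, dd x ≤ k := by
    intro x hx
    have h := Finset.card_le_card (hOx x hx)
    rw [hOc] at h
    simp only [invSets, Finset.mem_filter, Finset.mem_univ, true_and] at hx
    omega
  have : ∑ d ∈ Finset.Icc 1 k, (fixS τ d).card * (invSets τ (k-d)).card =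
      ((Finset.Icc 1 k).sigma (fun d => fixS τ d ×ˢ invSets τ (k-d))).card := by
    rw [Finset.card_sigma]; simp
  rw [this]
  refine Finset.card_le_card_of_injOn (fun x => ⟨dd x, (a x, x \ O x)⟩) ?_ ?_
  · intro x hx
    have hx' : x ∈ invSets τ k := hx
    have h1 := hle x hx
    have h2 := hOx x hx
    simp only [invSets, Finset.mem_filter, Finset.mem_univ, true_and] at hx'
    simp only [Finset.coe_sigma, Set.mem_sigma_iff, Finset.mem_coe, Finset.mem_Icc, Finset.mem_product,
      fixS, invSets, Finset.mem_filter, Finset.mem_univ, true_and]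
    refine ⟨⟨hpos x, h1⟩, ?_, ?_, ?_⟩
    · rw [← Equiv.Perm.iterate_eq_pow, hper]
    · rw [Finset.card_sdiff_of_subset h2, hOc, hx'.1]
    · rw [Finset.image_sdiff _ _ τ.injective, hOi, hx'.2]
  · intro x hx y hy hxy
    have hd : dd x = dd y := congrArg Sigma.fst hxy
    have h2 : a x = a y := by
      have := congrArg (fun s : (Σ _ : ℕ, α × Finset α) => s.2.1) hxy
      exact this
    have h3 : x \ O x = y \ O y := by
      have := congrArg (fun s : (Σ _ : ℕ, α × Finset α) => s.2.2) hxy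
      exact this
    have hOO : O x = O y := by simp only [hO, hd, h2]
    rw [← Finset.sdiff_union_of_subset (hOx x hx), h3, hOO, Finset.sdiff_union_of_subset (hOx y hy)]

lemma invSets_zero (τ : Perm α) : (invSets τ 0).card ≤ 1 := by
  refine Finset.card_le_one.2 ?_
  intro a ha b hb
  simp only [invSets, Finset.mem_filter, Finset.mem_univ, true_and, Finset.card_eq_zero] at ha hb
  rw [ha.1, hb.1]

lemma inv_small (τ : Perm α) (k : ℕ) (hk : k ∈ ({3, 4, 5} : Set ℕ)) (hN : 1 ≤ Fintype.card α) :
    (invSets τ k).card ≤ (Fintype.card α)^(k-3) * ((fixS τ 1).card^3 +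
      7 * ((fixS τ 1).card * (fixS τ 2).card) + (fixS τ 2).card + 5 * (fixS τ 3).card + 3) := by
  have r1 := inv_rec τ 1 (by norm_num)
  have r2 := inv_rec τ 2 (by norm_num)
  have r3 := inv_rec τ 3 (by norm_num)
  have r4 := inv_rec τ 4 (by norm_num)
  have r5 := inv_rec τ 5 (by norm_num)
  have r0 := invSets_zero τ
  have b : ∀ d, (fixS τ d).card ≤ Fintype.card α := fun d => Finset.card_le_univ _
  have b1 := b 1
  have b2 := b 2
  have b3 := b 3
  have b4 := b 4
  have b5 := b 5
  have e1 : Finset.Icc 1 1 = {1} := by decide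
  have e2 : Finset.Icc 1 2 = {1, 2} := by decide
  have e3 : Finset.Icc 1 3 = {1, 2, 3} := by decide
  have e4 : Finset.Icc 1 4 = {1, 2, 3, 4} := by decide
  have e5 : Finset.Icc 1 5 = {1, 2, 3, 4, 5} := by decide
  rw [e1] at r1
  rw [e2] at r2
  rw [e3] at r3
  rw [e4] at r4
  rw [e5] at r5
  clear b e1 e2 e3 e4 e5
  have fin : ∀ i3 i4 i5, (invSets τ 3).card = i3 → (invSets τ 4).card = i4 → (invSets τ 5).card = i5 →
      (invSets τ k).card = if k = 3 then i3 else if k = 4 then i4 else i5 := by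
    rintro i3 i4 i5 rfl rfl rfl
    rcases hk with rfl | rfl | rfl <;> rfl
  rw [fin _ _ _ rfl rfl rfl]
  clear fin
  simp at r1 r2 r3 r4 r5
  generalize Fintype.card α = N at *
  generalize (fixS τ 1).card = f1 at *
  generalize (fixS τ 2).card = f2 at *
  generalize (fixS τ 3).card = f3 at *
  generalize (fixS τ 4).card = f4 at *
  generalize (fixS τ 5).card = f5 at *
  generalize (invSets τ 0).card = i0 at *
  generalize (invSets τ 1).card = i1 at *
  generalize (invSets τ 2).card = i2 at *
  generalize (invSets τ 3).card = i3 at *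
  generalize (invSets τ 4).card = i4 at *
  generalize (invSets τ 5).card = i5 at *
  have s1 : i1 ≤ f1 := r1.trans (by nlinarith)
  have s2 : i2 ≤ f1^2 + f2 := by
    calc i2 ≤ _ := r2
      _ ≤ f1 * f1 + f2 * 1 := by gcongr
      _ = _ := by ring
  have s3 : i3 ≤ f1^3 + 2 * (f1 * f2) + f3 := by
    calc i3 ≤ _ := r3
      _ ≤ f1 * (f1^2 + f2) + (f2 * f1 + f3 * 1) := by gcongr
      _ = _ := by ring
  have s4 : i4 ≤ f1 * (f1^3 + 2 * (f1 * f2) + f3) + (f2 * (f1^2 + f2) + (f3 * f1 + f4 * 1)) := by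
    calc i4 ≤ _ := r4
      _ ≤ _ := by gcongr
  have s4' : i4 ≤ N * (f1^3 + 3 * (f1 * f2) + f2 + 2 * f3 + 1) := by
    calc i4 ≤ _ := s4
      _ = f1 * (f1^3 + 3 * (f1 * f2) + 2 * f3) + f2 * f2 + f4 := by ring
      _ ≤ N * (f1^3 + 3 * (f1 * f2) + 2 * f3) + N * f2 + N := by gcongr
      _ = _ := by ring
  have s5 : i5 ≤ N^2 * (f1^3 + 7 * (f1 * f2) + f2 + 5 * f3 + 3) := by
    calc i5 ≤ _ := r5
      _ ≤ f1 * (f1 * (f1^3 + 2 * (f1 * f2) + f3) + (f2 * (f1^2 + f2) + (f3 * f1 + f4 * 1)))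
          + (f2 * (f1^3 + 2 * (f1 * f2) + f3) + (f3 * (f1^2 + f2) + (f4 * f1 + f5 * 1))) := by gcongr
      _ = f1 * f1 * (f1^3 + 4 * (f1 * f2) + 3 * f3) + f2 * (3 * (f1 * f2)) + f2 * (2 * f3)
          + 2 * (f1 * f4) + f5 := by ring
      _ ≤ N * N * (f1^3 + 4 * (f1 * f2) + 3 * f3) + (N * N) * (3 * (f1 * f2)) + (N * N) * (2 * f3)
          + 2 * (N * N) + N * N := by
            have : f2 ≤ N * N := by nlinarith
            have : f5 ≤ N * N := by nlinarith
            gcongr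
      _ = N^2 * (f1^3 + 7 * (f1 * f2) + 5 * f3 + 3) := by ring
      _ ≤ _ := Nat.mul_le_mul_left _ (by omega)
  rcases hk with rfl | rfl | rfl
  · simp; linarith [Nat.zero_le (f1 * f2)]
  · refine le_trans (show _ ≤ i4 from le_refl _) (s4'.trans ?_)
    simp only [show 4 - 3 = 1 from rfl, pow_one]
    refine Nat.mul_le_mul_left _ ?_
    linarith [Nat.zero_le (f1 * f2)]
  · exact s5
end inv

def tw {n : ℕ} (a b : Perm (Fin n)) : Perm (Perm (Fin n)) :=
  (Equiv.mulLeft a).trans (Equiv.mulRight b⁻¹)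

lemma tw_apply {n : ℕ} (a b σ : Perm (Fin n)) : tw a b σ = a * σ * b⁻¹ := rfl

lemma tw_pow {n : ℕ} (a b σ : Perm (Fin n)) (d : ℕ) : (tw a b ^ d) σ = a^d * σ * (b^d)⁻¹ := by
  induction d with
  | zero => simp
  | succ d ih =>
    rw [pow_succ', Equiv.Perm.mul_apply, ih, tw_apply, pow_succ' a, pow_succ b]
    rw [show b ^ d * b = b * b ^ d from (pow_succ b d).symm.trans (pow_succ' b d)]
    group

def co {n : ℕ} (a b : Perm (Fin n)) : ℕ :=
  (Finset.univ.filter fun σ : Perm (Fin n) => a * σ = σ * b).card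

lemma fixS_tw {n : ℕ} (a b : Perm (Fin n)) (d : ℕ) : (fixS (tw a b) d).card = co (a^d) (b^d) := by
  unfold fixS co
  congr 1
  ext σ
  simp only [Finset.mem_filter, Finset.mem_univ, true_and]
  rw [tw_pow, mul_inv_eq_iff_eq_mul]

lemma co_le_left {n : ℕ} (a b : Perm (Fin n)) : co a b ≤ cen a := by
  unfold co
  rcases (Finset.univ.filter fun σ : Perm (Fin n) => a * σ = σ * b).eq_empty_or_nonempty with he | ⟨s, hs⟩
  · rw [he]; simp
  · simp only [Finset.mem_filter, Finset.mem_univ, true_and] at hs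
    refine Finset.card_le_card_of_injOn (fun σ => σ * s⁻¹) ?_ ?_
    · intro σ hσ
      simp only [Finset.coe_filter, Finset.mem_univ, true_and, Set.mem_ofPred_eq] at hσ ⊢
      have h' : s⁻¹ * a = b * s⁻¹ := by
        rw [inv_mul_eq_iff_eq_mul, ← mul_assoc, ← hs]; group
      rw [← mul_assoc, hσ, mul_assoc, mul_assoc, h']
    · intro x _ y _ h
      exact mul_right_cancel h

lemma co_le_right {n : ℕ} (a b : Perm (Fin n)) : co a b ≤ cen b := by
  refine le_trans ?_ (co_le_left b a)
  refine Finset.card_le_card_of_injOn (fun σ => σ⁻¹) ?_ ?_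
  · intro σ hσ
    simp only [Finset.coe_filter, Finset.mem_univ, true_and, Set.mem_ofPred_eq] at hσ ⊢
    rw [eq_inv_mul_iff_mul_eq, ← mul_assoc, ← hσ]; group
  · intro x _ y _ h
    exact inv_injective h

lemma sum_co {n : ℕ} (a : Perm (Fin n)) : ∑ b : Perm (Fin n), co a b ≤ n ! := by
  unfold co
  rw [← Finset.card_sigma, ← card_P]
  refine Finset.card_le_card_of_injOn (fun p => p.2) (by intro x _; simp) ?_
  rintro ⟨b, s⟩ h1 ⟨b', s'⟩ h2 h
  simp only [Finset.coe_sigma, Set.mem_sigma_iff, Finset.mem_coe, Finset.mem_filter, Finset.mem_univ,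
    true_and] at h1 h2 h
  subst h
  have : b = b' := mul_left_cancel (h1.symm.trans h2)
  rw [this]

def nt (n : ℕ) : Finset (Perm (Fin n) × Perm (Fin n)) := Finset.univ.filter fun p => p ≠ 1

lemma sum_nt_le {n : ℕ} (F : Perm (Fin n) → ℕ) :
    ∑ p ∈ nt n, co p.1 p.2 * F p.1 ≤
      n ! * ∑ a ∈ Finset.univ.filter (fun g : Perm (Fin n) => g ≠ 1), F a := by
  calc _ ≤ ∑ p ∈ (Finset.univ.filter (fun g : Perm (Fin n) => g ≠ 1)) ×ˢ
            (Finset.univ : Finset (Perm (Fin n))), co p.1 p.2 * F p.1 := by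
        refine Finset.sum_le_sum_of_ne_zero ?_
        rintro ⟨a, b⟩ hp h0
        simp only [Finset.mem_product, Finset.mem_filter, Finset.mem_univ, true_and, and_true]
        rintro rfl
        apply h0
        have : co 1 b = 0 := by
          rw [co, Finset.card_eq_zero, Finset.filter_eq_empty_iff]
          intro σ _ hσ
          rw [one_mul, left_eq_mul] at hσ
          subst hσ
          exact (Finset.mem_filter.1 hp).2 rfl
        simp [this]
    _ = ∑ a ∈ Finset.univ.filter (fun g : Perm (Fin n) => g ≠ 1), (∑ b, co a b) * F a := by
        rw [Finset.sum_product]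
        refine Finset.sum_congr rfl ?_
        intro a _
        rw [Finset.sum_mul]
    _ ≤ _ := by
        rw [Finset.mul_sum]
        refine Finset.sum_le_sum ?_
        intro a _
        exact Nat.mul_le_mul_right _ (sum_co a)

lemma sumA {n : ℕ} (hn : 2 ≤ n) : n^2 * ∑ p ∈ nt n, (co p.1 p.2)^3 ≤ 54 * (n !)^3 := by
  have h : ∑ p ∈ nt n, (co p.1 p.2)^3 ≤ ∑ p ∈ nt n, co p.1 p.2 * cen p.1 ^ 2 := by
    refine Finset.sum_le_sum ?_
    intro p _
    rw [pow_succ' _ 2]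
    gcongr
    exact co_le_left _ _
  have h2 := h.trans (sum_nt_le (fun a => cen a ^ 2))
  have h3 := sum_cen_sq n hn
  calc _ ≤ n^2 * (n ! * ∑ a ∈ Finset.univ.filter (fun g : Perm (Fin n) => g ≠ 1), cen a ^ 2) := by gcongr
    _ = n ! * (n^2 * ∑ a ∈ Finset.univ.filter (fun g : Perm (Fin n) => g ≠ 1), cen a ^ 2) := by ring
    _ ≤ n ! * (54 * (n !)^2) := by gcongr
    _ = _ := by ring

lemma sumB {n K : ℕ} (hn : 2 ≤ n) (hK : n^2 * rt n 2 ≤ K * n !) :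
    n^2 * ∑ p ∈ nt n, (co p.1 p.2 * co (p.1^2) (p.2^2)) ≤ (K + 54) * (n !)^3 := by
  have h : ∑ p ∈ nt n, (co p.1 p.2 * co (p.1^2) (p.2^2)) ≤ ∑ p ∈ nt n, co p.1 p.2 * cen (p.1^2) := by
    refine Finset.sum_le_sum ?_
    intro p _
    gcongr
    exact co_le_left _ _
  have h2 := h.trans (sum_nt_le (fun a => cen (a^2)))
  have h3 : n^2 * ∑ a ∈ Finset.univ.filter (fun g : Perm (Fin n) => g ≠ 1), cen (a^2)
      ≤ (K + 54) * (n !)^2 := by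
    calc _ ≤ n^2 * ∑ a : Perm (Fin n), cen (a^2) := by
          gcongr; exact Finset.filter_subset _ _
      _ ≤ ∑ a : Perm (Fin n), ((if a^2 = 1 then n^2 * n ! else 0) + 54 * n !) := by
          rw [Finset.mul_sum]
          refine Finset.sum_le_sum ?_
          intro a _
          split_ifs with h
          · exact (Nat.mul_le_mul_left _ (cen_le _)).trans (Nat.le_add_right _ _)
          · rw [zero_add]; exact cen_bound n hn _ h
      _ = n^2 * rt n 2 * n ! + 54 * (n !)^2 := by
          rw [Finset.sum_add_distrib, ← Finset.sum_filter, Finset.sum_const, Finset.sum_const, card_P]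
          simp only [smul_eq_mul, rt]
          ring
      _ ≤ K * n ! * n ! + 54 * (n !)^2 := by gcongr
      _ = _ := by ring
  calc _ ≤ n^2 * (n ! * ∑ a ∈ Finset.univ.filter (fun g : Perm (Fin n) => g ≠ 1), cen (a^2)) := by gcongr
    _ = n ! * (n^2 * ∑ a ∈ Finset.univ.filter (fun g : Perm (Fin n) => g ≠ 1), cen (a^2)) := by ring
    _ ≤ n ! * ((K + 54) * (n !)^2) := by gcongr
    _ = _ := by ring

lemma sumF {n K d : ℕ} (hn : 2 ≤ n) (hK : n * rt n d ≤ K * n !) :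
    n^2 * ∑ p ∈ nt n, co (p.1^d) (p.2^d) ≤ (K^2 + 54) * (n !)^3 := by
  calc _ ≤ n^2 * ∑ p : Perm (Fin n) × Perm (Fin n), co (p.1^d) (p.2^d) := by
        gcongr; exact Finset.subset_univ _
    _ ≤ ∑ p : Perm (Fin n) × Perm (Fin n),
          ((if p.1^d = 1 ∧ p.2^d = 1 then n^2 * n ! else 0) + 54 * n !) := by
        rw [Finset.mul_sum]
        refine Finset.sum_le_sum ?_
        intro p _
        split_ifs with h
        · exact (Nat.mul_le_mul_left _ ((co_le_left _ _).trans (cen_le _))).trans (Nat.le_add_right _ _)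
        · rw [zero_add]
          by_cases h1 : p.1^d = 1
          · have h2 : p.2^d ≠ 1 := fun h2 => h ⟨h1, h2⟩
            exact (Nat.mul_le_mul_left _ (co_le_right _ _)).trans (cen_bound n hn _ h2)
          · exact (Nat.mul_le_mul_left _ (co_le_left _ _)).trans (cen_bound n hn _ h1)
    _ = (n * rt n d)^2 * n ! + 54 * (n !)^3 := by
        rw [Finset.sum_add_distrib, ← Finset.sum_filter, Finset.sum_const, Finset.sum_const]
        have e : (Finset.univ.filter fun p : Perm (Fin n) × Perm (Fin n) => p.1^d = 1 ∧ p.2^d = 1).card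
            = rt n d * rt n d := by
          rw [rt, ← Finset.card_product, ← Finset.univ_product_univ, ← Finset.filter_product]
        rw [e, ← Finset.univ_product_univ, Finset.card_product, card_P]
        simp only [smul_eq_mul]
        ring
    _ ≤ (K * n !)^2 * n ! + 54 * (n !)^3 := by gcongr
    _ = _ := by ring

lemma n2_le (n : ℕ) : n^2 ≤ 4 * n ! := by
  rcases n with _ | _ | n
  · simp
  · simp
  · have := Nat.factorial_pos n
    rw [Nat.factorial_succ, Nat.factorial_succ]
    nlinarith [Nat.mul_le_mul_left ((n+1+1)*(n+1)) this]

lemma sum_inv : ∃ K : ℕ, ∀ n : ℕ, 3 ≤ n → ∀ k ∈ ({3, 4, 5} : Set ℕ),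
    n^2 * ∑ p ∈ nt n, (invSets (tw p.1 p.2) k).card ≤ K * (n !)^k := by
  obtain ⟨K, hK⟩ := rt2_bound
  refine ⟨54 + 7 * (K + 54) + (K^2 + 54) + 5 * (6^2 + 54) + 12, ?_⟩
  intro n hn k hk
  have hcard : Fintype.card (Perm (Fin n)) = n ! := by rw [Fintype.card_perm, Fintype.card_fin]
  have hA := sumA (n := n) (by omega)
  have hB := sumB (n := n) (by omega) (hK n)
  have hF := sumF (n := n) (d := 2) (K := K) (by omega) (by
    refine le_trans ?_ (hK n)
    gcongr
    nlinarith)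
  have hE := sumF (n := n) (d := 3) (K := 6) (by omega) (rt3_bound n hn)
  have hc : n^2 * (nt n).card ≤ 4 * (n !)^3 := by
    have : (nt n).card ≤ n ! * n ! := by
      refine (Finset.card_le_univ _).trans ?_
      rw [Fintype.card_prod, hcard]
    calc _ ≤ (4 * n !) * (n ! * n !) := Nat.mul_le_mul (n2_le n) this
      _ = _ := by ring
  have hpt : ∀ p ∈ nt n, (invSets (tw p.1 p.2) k).card ≤ (n !)^(k-3) * ((co p.1 p.2)^3 +
      7 * (co p.1 p.2 * co (p.1^2) (p.2^2)) + co (p.1^2) (p.2^2) + 5 * co (p.1^3) (p.2^3) + 3) := by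
    intro p _
    have h := inv_small (tw p.1 p.2) k hk Fintype.card_pos
    rw [hcard, fixS_tw, fixS_tw, fixS_tw, pow_one, pow_one] at h
    exact h
  have hk3 : (n !)^k = (n !)^(k-3) * (n !)^3 := by
    rw [← pow_add]; congr 1
    rcases hk with rfl | rfl | rfl <;> rfl
  calc _ ≤ n^2 * ∑ p ∈ nt n, (n !)^(k-3) * ((co p.1 p.2)^3 +
      7 * (co p.1 p.2 * co (p.1^2) (p.2^2)) + co (p.1^2) (p.2^2) + 5 * co (p.1^3) (p.2^3) + 3) := by
        exact Nat.mul_le_mul_left _ (Finset.sum_le_sum hpt)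
    _ = (n !)^(k-3) * (n^2 * ∑ p ∈ nt n, (co p.1 p.2)^3
        + 7 * (n^2 * ∑ p ∈ nt n, (co p.1 p.2 * co (p.1^2) (p.2^2)))
        + n^2 * ∑ p ∈ nt n, co (p.1^2) (p.2^2)
        + 5 * (n^2 * ∑ p ∈ nt n, co (p.1^3) (p.2^3)) + 3 * (n^2 * (nt n).card)) := by
        rw [← Finset.mul_sum]
        simp only [Finset.sum_add_distrib, ← Finset.mul_sum, Finset.sum_const, smul_eq_mul]
        ring
    _ ≤ (n !)^(k-3) * (54 * (n !)^3 + 7 * ((K + 54) * (n !)^3) + (K^2 + 54) * (n !)^3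
        + 5 * ((6^2 + 54) * (n !)^3) + 3 * (4 * (n !)^3)) := by gcongr
    _ = _ := by rw [hk3]; ring

@[reducible] def actK (n k : ℕ) : MulAction (Perm (Fin n) × Perm (Fin n)) {s : Finset (Perm (Fin n)) // s.card = k} where
  smul g x := ⟨x.1.image (tw g.1 g.2), by
    rw [Finset.card_image_of_injective _ (tw g.1 g.2).injective, x.2]⟩
  one_smul x := by
    apply Subtype.ext
    show x.1.image (tw 1 1) = x.1
    have : (tw (1 : Perm (Fin n)) 1 : Perm (Fin n) → Perm (Fin n)) = id := by
      funext σ; simp [tw_apply]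
    rw [this, Finset.image_id]
  mul_smul g h x := by
    apply Subtype.ext
    show x.1.image (tw (g.1 * h.1) (g.2 * h.2)) = (x.1.image (tw h.1 h.2)).image (tw g.1 g.2)
    rw [Finset.image_image]
    congr 1

lemma burnside (n k : ℕ) :
    T n k * (n ! * n !) = ∑ p : Perm (Fin n) × Perm (Fin n), (invSets (tw p.1 p.2) k).card := by
  classical
  let _ := actK n k
  have h := MulAction.sum_card_fixedBy_eq_card_orbits_mul_card_group
    (Perm (Fin n) × Perm (Fin n)) {s : Finset (Perm (Fin n)) // s.card = k}
  have hT : T n k = Fintype.card (Quotient (MulAction.orbitRel (Perm (Fin n) × Perm (Fin n))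
      {s : Finset (Perm (Fin n)) // s.card = k})) := by
    rw [← Nat.card_eq_fintype_card, T]
    refine Nat.card_congr (Quot.congrRight ?_)
    intro x y
    rw [MulAction.orbitRel_apply]
    constructor
    · rintro ⟨g1, g2, hg⟩
      rw [MulAction.mem_orbit_symm]
      refine ⟨(g1, g2⁻¹), ?_⟩
      apply Subtype.ext
      rw [← hg]
      show x.1.image (tw g1 g2⁻¹) = _
      congr 1
    · intro hxy
      rw [MulAction.mem_orbit_symm] at hxy
      obtain ⟨⟨g1, g2⟩, hg⟩ := hxy
      refine ⟨g1, g2⁻¹, ?_⟩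
      rw [← hg]
      rfl
  rw [← hT, Fintype.card_prod, Fintype.card_perm, Fintype.card_fin] at h
  rw [← h]
  refine Finset.sum_congr rfl ?_
  intro p _
  rw [← Fintype.card_coe]
  refine Fintype.card_congr ?_
  refine ⟨fun x => ⟨x.1.1, ?_⟩, fun x => ⟨⟨x.1, ?_⟩, ?_⟩, ?_, ?_⟩
  · have h2 : p • x.1 = x.1 := x.2
    simp only [invSets, Finset.mem_filter, Finset.mem_univ, true_and]
    exact ⟨x.1.2, congrArg Subtype.val h2⟩
  · have := x.2
    simp only [invSets, Finset.mem_filter, Finset.mem_univ, true_and] at this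
    exact this.1
  · have := x.2
    simp only [invSets, Finset.mem_filter, Finset.mem_univ, true_and] at this
    exact Subtype.ext this.2
  · intro x; rfl
  · intro x; rfl

lemma inv_one_le (n k : ℕ) : (invSets (tw (1 : Perm (Fin n)) 1) k).card ≤ (n !).choose k := by
  rw [← card_P n, ← Finset.card_powersetCard]
  refine Finset.card_le_card ?_
  intro x hx
  simp only [invSets, Finset.mem_filter, Finset.mem_univ, true_and] at hx
  rw [Finset.mem_powersetCard]
  exact ⟨Finset.subset_univ _, hx.1⟩

lemma pow_le_ch (N k : ℕ) (hk : k ∈ ({3, 4, 5} : Set ℕ)) (h : k + 3 ≤ N) :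
    N^k ≤ 29160 * N.choose k := by
  have h1 : (N + 1 - k)^k ≤ k ! * N.choose k := by
    rw [← Nat.descFactorial_eq_factorial_mul_choose]
    exact N.pow_sub_le_descFactorial k
  have h2 : N ≤ 3 * (N + 1 - k) := by
    rcases hk with rfl | rfl | rfl <;> omega
  have h3 : 3^k * k ! ≤ 29160 := by
    rcases hk with rfl | rfl | rfl <;> decide
  calc N^k ≤ (3 * (N + 1 - k))^k := by gcongr
    _ = 3^k * (N + 1 - k)^k := mul_pow _ _ _
    _ ≤ 3^k * (k ! * N.choose k) := by gcongr
    _ = 3^k * k ! * N.choose k := by ring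
    _ ≤ _ := by gcongr

/-- There is a constant `C > 0`, independent of `k`, such that for all `n ≥ 1` and each
`k ∈ {3,4,5}` with `k ≤ n! − 3`, `T(n,k) ≤ (1 + C/n²)·(1/n!²)·binom(n!,k)`. -/
theorem T_upper_bound_small_k :
    ∃ C : ℝ, 0 < C ∧ ∀ n : ℕ, 1 ≤ n → ∀ k ∈ ({3, 4, 5} : Set ℕ), k + 3 ≤ n.factorial →
      (T n k : ℝ) ≤
        (1 + C / (n : ℝ) ^ 2) * ((n.factorial.choose k : ℝ) / (n.factorial : ℝ) ^ 2) := by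
  obtain ⟨K, hK⟩ := sum_inv
  refine ⟨(K * 29160 + 1 : ℕ), by positivity, ?_⟩
  intro n hn k hk hkn
  have hn3 : 3 ≤ n := by
    by_contra hlt
    have h3 : 3 ≤ k := by rcases hk with rfl | rfl | rfl <;> norm_num
    have : n ! ≤ 2 ! := Nat.factorial_le (by omega)
    have h2 : 2 ! = 2 := rfl
    omega
  have hb := burnside n k
  have hs : ∑ p : Perm (Fin n) × Perm (Fin n), (invSets (tw p.1 p.2) k).card
      = (invSets (tw (1 : Perm (Fin n)) 1) k).card + ∑ p ∈ nt n, (invSets (tw p.1 p.2) k).card := by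
    rw [nt, Finset.filter_ne']
    exact (Finset.add_sum_erase _ (fun p : Perm (Fin n) × Perm (Fin n) =>
      (invSets (tw p.1 p.2) k).card) (Finset.mem_univ (1 : Perm (Fin n) × Perm (Fin n)))).symm
  have h1 := inv_one_le n k
  have h2 := hK n hn3 k hk
  have h3 := pow_le_ch (n !) k hk hkn
  have h4 : n^2 * (T n k * (n !)^2) ≤ (n^2 + (K * 29160 + 1 : ℕ)) * (n !).choose k := by
    calc n^2 * (T n k * (n !)^2) = n^2 * (T n k * (n ! * n !)) := by ring
      _ = n^2 * (invSets (tw (1 : Perm (Fin n)) 1) k).card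
          + n^2 * ∑ p ∈ nt n, (invSets (tw p.1 p.2) k).card := by rw [hb, hs]; ring
      _ ≤ n^2 * (n !).choose k + K * (29160 * (n !).choose k) := by
          exact Nat.add_le_add (Nat.mul_le_mul_left _ h1) (h2.trans (Nat.mul_le_mul_left _ h3))
      _ ≤ _ := by nlinarith [Nat.zero_le ((n !).choose k)]
  have hN : (0:ℝ) < (n ! : ℝ) := by exact_mod_cast Nat.factorial_pos n
  have hn0 : (0:ℝ) < (n : ℝ) := by exact_mod_cast (by omega : 0 < n)
  have h5 : (n:ℝ)^2 * (T n k * (n ! : ℝ)^2) ≤ ((n:ℝ)^2 + (K * 29160 + 1 : ℕ)) * ((n !).choose k : ℝ) := by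
    exact_mod_cast h4
  have e : (1 + ((K * 29160 + 1 : ℕ) : ℝ) / (n : ℝ) ^ 2) * (((n !).choose k : ℝ) / (n ! : ℝ) ^ 2)
      = (((n:ℝ)^2 + (K * 29160 + 1 : ℕ)) * ((n !).choose k : ℝ)) / ((n:ℝ)^2 * (n ! : ℝ)^2) := by
    field_simp
  rw [e, le_div_iff₀ (by positivity)]
  linarith
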